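/- The image of Ψ restricted to normalized equivariant cochains lands in H-constant cochains: if φ : H ⊗ A^{⊗(n+1)} → ℂ is equivariant and normalized (vanishes when any aʲ = 1), then Ψφ(x⁰,…,xⁿ) = 0 whenever some xʲ with j ≥ 1 equals 1 ⊗ h for some h ∈ H, and likewise b(Ψφ) vanishes under the same condition. -/

import Mathlib

noncomputable section

open TensorProduct

variable {H A : Type} [Ring H] [HopfAlgebra ℂ H] [Ring A] [Algebra ℂ A]

/-- `sweedler N Δ₁ Δ₂ k g F` is the Sweedler sum `Σ F (g₍₁₎, …, g₍ₖ₊₁₎)`, computed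
from a chosen finite representation `comul g = Σ_{i < N g} Δ₁ g i ⊗ Δ₂ g i` of the
comultiplication. -/
def sweedler (N : H → ℕ) (Δ₁ Δ₂ : H → ℕ → H) :
    (k : ℕ) → H → ((Fin (k+1) → H) → ℂ) → ℂ
  | 0, g, F => F ![g]
  | k+1, g, F => ∑ i ∈ Finset.range (N g),
      sweedler N Δ₁ Δ₂ k (Δ₂ g i) (fun v => F (Fin.cons (Δ₁ g i) v))

/-- The multiplication of the crossed product `A ⋊ H`, as a linear map on
`(A ⊗ H) ⊗ (A ⊗ H)`; on pure tensors it is `(a ⊗ h)(b ⊗ g) = a h₍₁₎(b) ⊗ h₍₂₎ g`. -/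
def cpMul (ρ : H →ₗ[ℂ] A →ₗ[ℂ] A) :
    (A ⊗[ℂ] H) ⊗[ℂ] (A ⊗[ℂ] H) →ₗ[ℂ] A ⊗[ℂ] H :=
  (LinearMap.rTensor H (LinearMap.mul' ℂ A)) ∘ₗ
  (TensorProduct.assoc ℂ A A H).symm.toLinearMap ∘ₗ
  (LinearMap.lTensor A (TensorProduct.map (TensorProduct.lift ρ) (LinearMap.mul' ℂ H))) ∘ₗ
  (LinearMap.lTensor A (TensorProduct.tensorTensorTensorComm ℂ H H A H).toLinearMap) ∘ₗ
  (LinearMap.lTensor A (LinearMap.rTensor (A ⊗[ℂ] H) (Coalgebra.comul (R := ℂ)))) ∘ₗ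
  (TensorProduct.assoc ℂ A H (A ⊗[ℂ] H)).toLinearMap

/-- The tuple obtained from `x` by replacing the pair `(xʲ, xʲ⁺¹)` by the single
entry `y` (used with `y = xʲ xʲ⁺¹` for the `j`-th face map). -/
def faceTup {α : Type} {n : ℕ} (j : Fin (n+1)) (y : α) (x : Fin (n+2) → α) :
    Fin (n+1) → α :=
  fun k => if (k : ℕ) < (j : ℕ) then x k.castSucc else if k = j then y else x k.succ

/-- The `i`-th term of the product `(p.1 ⊗ p.2)(q.1 ⊗ q.2)` in `A ⋊ H`, for the chosen
representation of the comultiplication: `p.1 · (Δ₁ p.2 i)(q.1) ⊗ (Δ₂ p.2 i) q.2`. -/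
def cpPairTerm (Δ₁ Δ₂ : H → ℕ → H) (ρ : H →ₗ[ℂ] A →ₗ[ℂ] A) (p q : A × H) (i : ℕ) :
    A × H :=
  (p.1 * ρ (Δ₁ p.2 i) q.1, Δ₂ p.2 i * q.2)

/-- The Hochschild coboundary of a cochain on the crossed product `A ⋊ H`. -/
def cpb (ρ : H →ₗ[ℂ] A →ₗ[ℂ] A) {n : ℕ} (f : (Fin (n+1) → A ⊗[ℂ] H) → ℂ) :
    (Fin (n+2) → A ⊗[ℂ] H) → ℂ := fun x =>
  (∑ j : Fin (n+1), (-1 : ℂ) ^ (j : ℕ) *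
      f (faceTup j (cpMul ρ (x j.castSucc ⊗ₜ[ℂ] x j.succ)) x))
  + (-1 : ℂ) ^ (n+1) *
      f (fun k => if (k : ℕ) = 0 then cpMul ρ (x (Fin.last (n+1)) ⊗ₜ[ℂ] x 0)
                  else x k.castSucc)

/-- `f` vanishes whenever some argument in position `≥ 1` lies in the subalgebra
`1 ⊗ H` of `A ⋊ H`. -/
def HConstVanish {m : ℕ} (f : (Fin m → A ⊗[ℂ] H) → ℂ) : Prop :=
  ∀ x : Fin m → A ⊗[ℂ] H,
    (∃ j : Fin m, 0 < (j : ℕ) ∧ ∃ h : H, x j = (1 : A) ⊗ₜ[ℂ] h) → f x = 0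

/-- An `H`-constant cochain on `A ⋊ H`: both `f` and `bf` vanish whenever some
argument in position `≥ 1` lies in `1 ⊗ H`. -/
def IsHConstant (ρ : H →ₗ[ℂ] A →ₗ[ℂ] A) {n : ℕ}
    (f : MultilinearMap ℂ (fun _ : Fin (n+1) => A ⊗[ℂ] H) ℂ) : Prop :=
  HConstVanish ⇑f ∧ HConstVanish (cpb ρ ⇑f)

/-- Auxiliary recursion for `Ψ`: processes the pairs `x¹, …, xᵏ`, keeping an
accumulated Hopf algebra element `g`; at each step `Δg = g₍₁₎ ⊗ g₍₂₎` is split, the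
current slot becomes `g₍₁₎(aʲ)` and the accumulator becomes `g₍₂₎ hʲ`. -/
def psiAux (N : H → ℕ) (Δ₁ Δ₂ : H → ℕ → H) (ρ : H →ₗ[ℂ] A →ₗ[ℂ] A) :
    (k : ℕ) → H → (Fin k → A × H) → (H → (Fin k → A) → ℂ) → ℂ
  | 0, g, _, F => F g ![]
  | k+1, g, x, F => ∑ i ∈ Finset.range (N g),
      psiAux N Δ₁ Δ₂ ρ k (Δ₂ g i * (x 0).2) (fun j => x j.succ)
        (fun h v => F h (Fin.cons (ρ (Δ₁ g i) (x 0).1) v))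

/-- The value of `Ψφ` on the elementary tensors `a⁰ ⊗ h⁰, …, aⁿ ⊗ hⁿ`:
`Ψ(φ)(a⁰⊗h⁰, …, aⁿ⊗hⁿ) = φ(h⁰₍ₙ₊₁₎ ⋯ h^{n-1}₍₂₎ hⁿ, a⁰, h⁰₍₁₎(a¹), …,
h⁰₍ₙ₎⋯h^{n-1}₍₁₎(aⁿ))`. -/
def psiV (N : H → ℕ) (Δ₁ Δ₂ : H → ℕ → H) (ρ : H →ₗ[ℂ] A →ₗ[ℂ] A) {n : ℕ}
    (φf : H → (Fin (n+1) → A) → ℂ) (x : Fin (n+1) → A × H) : ℂ :=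
  psiAux N Δ₁ Δ₂ ρ n ((x 0).2) (fun j => x j.succ)
    (fun h v => φf h (Fin.cons (x 0).1 v))

/-- The equivariance condition `φ(S(g₍₂₎) h g₍₁₎, a⁰, …, aⁿ) =
φ(h, g₍₁₎(a⁰), …, g₍ₙ₊₁₎(aⁿ))` for a cochain `φ : H ⊗ A^{⊗(n+1)} → ℂ`. -/
def IsEquivariant (N : H → ℕ) (Δ₁ Δ₂ : H → ℕ → H) (ρ : H →ₗ[ℂ] A →ₗ[ℂ] A) {n : ℕ}
    (φf : H → (Fin (n+1) → A) → ℂ) : Prop :=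
  ∀ (g h : H) (a : Fin (n+1) → A),
    sweedler N Δ₁ Δ₂ 1 g
      (fun ℓ => φf (HopfAlgebra.antipode (R := ℂ) (ℓ 1) * h * ℓ 0) a)
      = sweedler N Δ₁ Δ₂ n g (fun ℓ => φf h (fun j => ρ (ℓ j) (a j)))

/-- The cyclic operator on equivariant cochains:
`t φ(h, a⁰, …, aⁿ) = φ(h₍₂₎, S⁻¹(h₍₁₎)(aⁿ), a⁰, …, aⁿ⁻¹)`. -/
def cycOpEq (N : H → ℕ) (Δ₁ Δ₂ : H → ℕ → H) (ρ : H →ₗ[ℂ] A →ₗ[ℂ] A)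
    (Sinv : H →ₗ[ℂ] H) {n : ℕ} (φf : H → (Fin (n+1) → A) → ℂ) :
    H → (Fin (n+1) → A) → ℂ := fun h a =>
  sweedler N Δ₁ Δ₂ 1 h (fun ℓ =>
    φf (ℓ 1) (Fin.cons (ρ (Sinv (ℓ 0)) (a (Fin.last n))) (fun j : Fin n => a j.castSucc)))

/-- The map `Φ`: `(Φf)(h, a⁰, …, aⁿ) = f(a⁰ ⊗ 1, …, aⁿ⁻¹ ⊗ 1, aⁿ ⊗ h)`. -/
def phiV {n : ℕ} (f : MultilinearMap ℂ (fun _ : Fin (n+1) => A ⊗[ℂ] H) ℂ) :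
    H → (Fin (n+1) → A) → ℂ := fun h a =>
  f (fun i => if i = Fin.last n then a i ⊗ₜ[ℂ] h else a i ⊗ₜ[ℂ] (1 : H))



/-- cochains -/
abbrev VV (H A : Type) [Ring H] [HopfAlgebra ℂ H] [Ring A] [Algebra ℂ A] (k : ℕ) : Type :=
  H →ₗ[ℂ] MultilinearMap ℂ (fun _ : Fin k => A) ℂ

def cc (k : ℕ) : VV H A (k+1) →ₗ[ℂ] (A →ₗ[ℂ] VV H A k) :=
  LinearMap.lflip.toLinearMap ∘ₗ LinearMap.compRight ℂ
    (multilinearCurryLeftEquiv ℂ (fun _ : Fin (k+1) => A) ℂ).toLinearMap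

theorem cc_apply (k : ℕ) (F : VV H A (k+1)) (a : A) (h : H) (v : Fin k → A) :
    cc k F a h v = F h (Fin.cons a v) := rfl

def LL (ρ : H →ₗ[ℂ] A →ₗ[ℂ] A) : (k : ℕ) → (Fin k → A × H) → (VV H A k →ₗ[ℂ] H →ₗ[ℂ] ℂ)
  | 0, _ => 
    { toFun := fun F =>
        { toFun := fun g => F g ![]
          map_add' := by intros; simp
          map_smul' := by intros; simp }
      map_add' := by intros; ext; simp
      map_smul' := by intros; ext; simp }
  | k+1, x =>
    { toFun := fun F => TensorProduct.lift (LinearMap.mk₂ ℂ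
          (fun u v : H => LL ρ k (fun j => x j.succ) (cc k F (ρ u (x 0).1)) (v * (x 0).2))
          (by intros; simp) (by intros; simp) (by intros; simp [add_mul]) (by intros; simp))
        ∘ₗ Coalgebra.comul (R := ℂ)
      map_add' := by
        intro F F'
        rw [← LinearMap.add_comp]
        congr 1
        ext; simp
      map_smul' := by
        intro r F
        simp only [RingHom.id_apply]
        rw [← LinearMap.smul_comp]
        congr 1
        ext; simp }

def DD (ρ : H →ₗ[ℂ] A →ₗ[ℂ] A) : (k : ℕ) → H →ₗ[ℂ]
    (MultilinearMap ℂ (fun _ : Fin k => A) ℂ) →ₗ[ℂ] (MultilinearMap ℂ (fun _ : Fin k => A) ℂ)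
  | 0 => (Coalgebra.counit (R := ℂ) (A := H)).smulRight LinearMap.id
  | k+1 => TensorProduct.lift (LinearMap.mk₂ ℂ
      (fun u v : H => (multilinearCurryLeftEquiv ℂ (fun _ : Fin (k+1) => A) ℂ).symm.toLinearMap ∘ₗ
        ((LinearMap.llcomp ℂ A _ _ (DD ρ k v)) ∘ₗ (LinearMap.lcomp ℂ _ (ρ u))) ∘ₗ
        (multilinearCurryLeftEquiv ℂ (fun _ : Fin (k+1) => A) ℂ).toLinearMap)
        (by intros; ext; simp) (by intros; ext; simp)
        (by intros; ext; simp) (by intros; ext; simp))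
    ∘ₗ Coalgebra.comul (R := ℂ)

section
variable (N : H → ℕ) (Δ₁ Δ₂ : H → ℕ → H)
    (hrep : ∀ g : H, (Coalgebra.comul (R := ℂ) g : H ⊗[ℂ] H) =
      ∑ i ∈ Finset.range (N g), Δ₁ g i ⊗ₜ[ℂ] Δ₂ g i)
    (ρ : H →ₗ[ℂ] A →ₗ[ℂ] A)

theorem LL_zero (x : Fin 0 → A × H) (F : VV H A 0) (g : H) : LL ρ 0 x F g = F g ![] := by
  simp [LL]

theorem LL_succ
    (hrep : ∀ g : H, (Coalgebra.comul (R := ℂ) g : H ⊗[ℂ] H) =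
      ∑ i ∈ Finset.range (N g), Δ₁ g i ⊗ₜ[ℂ] Δ₂ g i)
    (k : ℕ) (x : Fin (k+1) → A × H) (F : VV H A (k+1)) (g : H) :
    LL ρ (k+1) x F g = ∑ i ∈ Finset.range (N g),
      LL ρ k (fun j => x j.succ) (cc k F (ρ (Δ₁ g i) (x 0).1)) (Δ₂ g i * (x 0).2) := by
  simp [LL, hrep g]

theorem DD_zero (g : H) (M : MultilinearMap ℂ (fun _ : Fin 0 => A) ℂ) :
    DD ρ 0 g M = Coalgebra.counit (R := ℂ) g • M := by
  simp [DD]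

theorem DD_succ
    (hrep : ∀ g : H, (Coalgebra.comul (R := ℂ) g : H ⊗[ℂ] H) =
      ∑ i ∈ Finset.range (N g), Δ₁ g i ⊗ₜ[ℂ] Δ₂ g i)
    (k : ℕ) (g : H) (M : MultilinearMap ℂ (fun _ : Fin (k+1) => A) ℂ) (v : Fin (k+1) → A) :
    DD ρ (k+1) g M v = ∑ i ∈ Finset.range (N g),
      DD ρ k (Δ₂ g i) (M.curryLeft (ρ (Δ₁ g i) (v 0))) (Fin.tail v) := by
  simp [DD, hrep g]

theorem psiAux_eq
    (hrep : ∀ g : H, (Coalgebra.comul (R := ℂ) g : H ⊗[ℂ] H) =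
      ∑ i ∈ Finset.range (N g), Δ₁ g i ⊗ₜ[ℂ] Δ₂ g i)
    (k : ℕ) (g : H) (x : Fin k → A × H) (F : VV H A k) :
    psiAux N Δ₁ Δ₂ ρ k g x (fun h v => F h v) = LL ρ k x F g := by
  induction k generalizing g with
  | zero => simp [psiAux, LL_zero]
  | succ k ih =>
    rw [LL_succ N Δ₁ Δ₂ ρ hrep]
    simp only [psiAux]
    refine Finset.sum_congr rfl fun i _ => ?_
    rw [← ih]
    rfl

theorem psiV_eq
    (hrep : ∀ g : H, (Coalgebra.comul (R := ℂ) g : H ⊗[ℂ] H) =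
      ∑ i ∈ Finset.range (N g), Δ₁ g i ⊗ₜ[ℂ] Δ₂ g i)
    (hρ_one : ρ 1 = LinearMap.id)
    (n : ℕ) (φ : VV H A (n+1)) (x : Fin (n+1) → A × H) :
    psiV N Δ₁ Δ₂ ρ (fun h a => φ h a) x = LL ρ (n+1) x φ 1 := by
  have : LL ρ (n+1) x φ 1 = LL ρ n (fun j => x j.succ) (cc n φ (x 0).1) (x 0).2 := by
    simp [LL, hρ_one, Algebra.TensorProduct.one_def]
  rw [this, ← psiAux_eq N Δ₁ Δ₂ ρ hrep]
  rfl

theorem counit_sum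
    (hrep : ∀ g : H, (Coalgebra.comul (R := ℂ) g : H ⊗[ℂ] H) =
      ∑ i ∈ Finset.range (N g), Δ₁ g i ⊗ₜ[ℂ] Δ₂ g i) (g : H) :
    ∑ i ∈ Finset.range (N g), Coalgebra.counit (R := ℂ) (Δ₁ g i) • Δ₂ g i = g := by
  have := congrArg (TensorProduct.lid ℂ H) (Coalgebra.rTensor_counit_comul (R := ℂ) g)
  simpa [hrep g] using this

theorem counit_sum'
    (hrep : ∀ g : H, (Coalgebra.comul (R := ℂ) g : H ⊗[ℂ] H) =
      ∑ i ∈ Finset.range (N g), Δ₁ g i ⊗ₜ[ℂ] Δ₂ g i) (g : H) :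
    ∑ i ∈ Finset.range (N g), Coalgebra.counit (R := ℂ) (Δ₂ g i) • Δ₁ g i = g := by
  have := congrArg (TensorProduct.rid ℂ H) (Coalgebra.lTensor_counit_comul (R := ℂ) g)
  simpa [hrep g] using this

theorem antip_sum
    (hrep : ∀ g : H, (Coalgebra.comul (R := ℂ) g : H ⊗[ℂ] H) =
      ∑ i ∈ Finset.range (N g), Δ₁ g i ⊗ₜ[ℂ] Δ₂ g i) (g : H) :
    ∑ i ∈ Finset.range (N g), HopfAlgebra.antipode (R := ℂ) (Δ₁ g i) * Δ₂ g i
      = algebraMap ℂ H (Coalgebra.counit (R := ℂ) g) := by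
  have := LinearMap.congr_fun (HopfAlgebra.mul_antipode_rTensor_comul (R := ℂ) (A := H)) g
  simpa [hrep g] using this

theorem coassoc_sum
    (hrep : ∀ g : H, (Coalgebra.comul (R := ℂ) g : H ⊗[ℂ] H) =
      ∑ i ∈ Finset.range (N g), Δ₁ g i ⊗ₜ[ℂ] Δ₂ g i)
    (T : H →ₗ[ℂ] H →ₗ[ℂ] H →ₗ[ℂ] ℂ) (g : H) :
    ∑ i ∈ Finset.range (N g), ∑ j ∈ Finset.range (N (Δ₁ g i)),
      T (Δ₁ (Δ₁ g i) j) (Δ₂ (Δ₁ g i) j) (Δ₂ g i) =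
    ∑ i ∈ Finset.range (N g), ∑ j ∈ Finset.range (N (Δ₂ g i)),
      T (Δ₁ g i) (Δ₁ (Δ₂ g i) j) (Δ₂ (Δ₂ g i) j) := by
  have := congrArg (TensorProduct.lift (TensorProduct.uncurry (RingHom.id ℂ) H H (H →ₗ[ℂ] ℂ) T) ∘ₗ
    (TensorProduct.assoc ℂ H H H).symm.toLinearMap)
    (Coalgebra.coassoc_apply (R := ℂ) g)
  simpa [hrep, TensorProduct.sum_tmul, TensorProduct.tmul_sum] using this

theorem comul_mul_sum
    (hrep : ∀ g : H, (Coalgebra.comul (R := ℂ) g : H ⊗[ℂ] H) =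
      ∑ i ∈ Finset.range (N g), Δ₁ g i ⊗ₜ[ℂ] Δ₂ g i)
    (B : H →ₗ[ℂ] H →ₗ[ℂ] ℂ) (g h : H) :
    ∑ i ∈ Finset.range (N (g * h)), B (Δ₁ (g * h) i) (Δ₂ (g * h) i) =
    ∑ i ∈ Finset.range (N g), ∑ j ∈ Finset.range (N h),
      B (Δ₁ g i * Δ₁ h j) (Δ₂ g i * Δ₂ h j) := by
  have := congrArg (TensorProduct.lift B) (Bialgebra.comul_mul (R := ℂ) g h)
  rw [hrep (g * h), hrep g, hrep h, Finset.sum_mul_sum] at this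
  simpa using this

/-- diagonal action on cochains -/
def actF (k : ℕ) : H →ₗ[ℂ] VV H A k →ₗ[ℂ] VV H A k :=
  TensorProduct.lift (LinearMap.mk₂ ℂ
    (fun u v : H => (LinearMap.llcomp ℂ H _ _ (DD ρ k u)) ∘ₗ
      (LinearMap.lcomp ℂ _ (LinearMap.mulLeft ℂ v)))
    (by intros; ext; simp) (by intros; ext; simp)
    (by intros; ext; simp [add_mul]) (by intros; ext; simp))
  ∘ₗ Coalgebra.comul (R := ℂ)

theorem actF_apply
    (hrep : ∀ g : H, (Coalgebra.comul (R := ℂ) g : H ⊗[ℂ] H) =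
      ∑ i ∈ Finset.range (N g), Δ₁ g i ⊗ₜ[ℂ] Δ₂ g i)
    (k : ℕ) (g h : H) (F : VV H A k) :
    actF ρ k g F h = ∑ i ∈ Finset.range (N g), DD ρ k (Δ₁ g i) (F (Δ₂ g i * h)) := by
  simp [actF, hrep g]

theorem cc_actF
    (hrep : ∀ g : H, (Coalgebra.comul (R := ℂ) g : H ⊗[ℂ] H) =
      ∑ i ∈ Finset.range (N g), Δ₁ g i ⊗ₜ[ℂ] Δ₂ g i)
    (k : ℕ) (g : H) (F : VV H A (k+1)) (a : A) :
    cc k (actF ρ (k+1) g F) a =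
      ∑ i ∈ Finset.range (N g), actF ρ k (Δ₂ g i) (cc k F (ρ (Δ₁ g i) a)) := by
  ext h v
  rw [cc_apply, actF_apply N Δ₁ Δ₂ ρ hrep]
  simp only [LinearMap.sum_apply, MultilinearMap.sum_apply, DD_succ N Δ₁ Δ₂ ρ hrep,
    actF_apply N Δ₁ Δ₂ ρ hrep, Fin.cons_zero, Fin.tail_cons]
  have := coassoc_sum N Δ₁ Δ₂ hrep
    (LinearMap.mk₂ ℂ (fun p q : H =>
      ({ toFun := fun r => DD ρ k q (cc k F (ρ p a) (r * h)) v
         map_add' := by intros; simp [add_mul]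
         map_smul' := by intros; simp } : H →ₗ[ℂ] ℂ))
      (by intros; ext; simp) (by intros; ext; simp)
      (by intros; ext; simp) (by intros; ext; simp)) g
  exact this

theorem LL_mul
    (hrep : ∀ g : H, (Coalgebra.comul (R := ℂ) g : H ⊗[ℂ] H) =
      ∑ i ∈ Finset.range (N g), Δ₁ g i ⊗ₜ[ℂ] Δ₂ g i)
    (hρ_mul : ∀ g h : H, ρ (g * h) = ρ g ∘ₗ ρ h)
    (k : ℕ) (x : Fin k → A × H) (F : VV H A k) (g K : H) :
    LL ρ k x F (g * K) = LL ρ k x (actF ρ k g F) K := by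
  induction k generalizing g K with
  | zero =>
    rw [LL_zero, LL_zero, actF_apply N Δ₁ Δ₂ ρ hrep]
    simp only [DD_zero]
    conv_lhs => rw [← counit_sum N Δ₁ Δ₂ hrep g]
    simp [Finset.sum_mul]
  | succ k ih =>
    rw [LL_succ N Δ₁ Δ₂ ρ hrep, LL_succ N Δ₁ Δ₂ ρ hrep]
    have := comul_mul_sum N Δ₁ Δ₂ hrep (LinearMap.mk₂ ℂ
          (fun u v : H => LL ρ k (fun j => x j.succ) (cc k F (ρ u (x 0).1)) (v * (x 0).2))
          (by intros; simp) (by intros; simp) (by intros; simp [add_mul]) (by intros; simp)) g K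
    simp only [LinearMap.mk₂_apply] at this
    rw [this, Finset.sum_comm]
    refine Finset.sum_congr rfl fun j _ => ?_
    rw [cc_actF N Δ₁ Δ₂ ρ hrep]
    simp only [map_sum, LinearMap.sum_apply]
    refine Finset.sum_congr rfl fun i _ => ?_
    rw [mul_assoc, ih, hρ_mul]
    rfl

theorem sweedler_eq
    (hrep : ∀ g : H, (Coalgebra.comul (R := ℂ) g : H ⊗[ℂ] H) =
      ∑ i ∈ Finset.range (N g), Δ₁ g i ⊗ₜ[ℂ] Δ₂ g i)
    (k : ℕ) (g : H) (M : MultilinearMap ℂ (fun _ : Fin (k+1) => A) ℂ) (v : Fin (k+1) → A) :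
    sweedler N Δ₁ Δ₂ k g (fun ℓ => M (fun j => ρ (ℓ j) (v j))) = DD ρ (k+1) g M v := by
  induction k generalizing g with
  | zero =>
    rw [DD_succ N Δ₁ Δ₂ ρ hrep]
    simp only [DD_zero, sweedler]
    have h1 : ∀ u : H, M (fun j => ρ (![u] j) (v j)) = M.curryLeft (ρ u (v 0)) (Fin.tail v) := by
      intro u
      rw [MultilinearMap.curryLeft_apply]
      congr 1
      funext j
      fin_cases j
      simp
    rw [h1]
    conv_lhs => rw [← counit_sum' N Δ₁ Δ₂ hrep g]
    simp only [map_sum, map_smul, LinearMap.sum_apply, LinearMap.smul_apply,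
      MultilinearMap.sum_apply, MultilinearMap.smul_apply]
  | succ k ih =>
    rw [DD_succ N Δ₁ Δ₂ ρ hrep]
    simp only [sweedler]
    refine Finset.sum_congr rfl fun i _ => ?_
    rw [← ih]
    congr 1
    funext ℓ
    rw [MultilinearMap.curryLeft_apply]
    congr 1
    funext j
    refine Fin.cases ?_ (fun j => ?_) j
    · simp
    · simp [Fin.tail]

/-- right translation -/
def rmul (k : ℕ) (h : H) (F : VV H A k) : VV H A k := F ∘ₗ LinearMap.mulRight ℂ h

theorem actF_equiv
    (hrep : ∀ g : H, (Coalgebra.comul (R := ℂ) g : H ⊗[ℂ] H) =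
      ∑ i ∈ Finset.range (N g), Δ₁ g i ⊗ₜ[ℂ] Δ₂ g i)
    (n : ℕ) (φ : VV H A (n+1))
    (hequiv : IsEquivariant N Δ₁ Δ₂ ρ (fun h a => φ h a)) (g : H) :
    actF ρ (n+1) g φ = rmul (n+1) g φ := by
  ext K v
  rw [actF_apply N Δ₁ Δ₂ ρ hrep, MultilinearMap.sum_apply]
  have h1 : ∀ u w : H, DD ρ (n+1) u (φ w) v = ∑ j ∈ Finset.range (N u),
      φ (HopfAlgebra.antipode (R := ℂ) (Δ₂ u j) * w * Δ₁ u j) v := by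
    intro u w
    rw [← sweedler_eq N Δ₁ Δ₂ ρ hrep, ← hequiv u w v]
    simp [sweedler]
  simp only [h1]
  have := coassoc_sum N Δ₁ Δ₂ hrep
    (LinearMap.mk₂ ℂ (fun p q : H =>
      ({ toFun := fun r => φ (HopfAlgebra.antipode (R := ℂ) q * (r * K) * p) v
         map_add' := by intros; simp [add_mul, mul_add]
         map_smul' := by intros; simp } : H →ₗ[ℂ] ℂ))
      (by intros; ext; simp [mul_add]) (by intros; ext; simp)
      (by intros; ext; simp [add_mul]) (by intros; ext; simp)) g
  refine Eq.trans this ?_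
  simp only [LinearMap.mk₂_apply, LinearMap.coe_mk, AddHom.coe_mk]
  have h2 : ∀ i, ∑ j ∈ Finset.range (N (Δ₂ g i)),
      φ (HopfAlgebra.antipode (R := ℂ) (Δ₁ (Δ₂ g i) j) * (Δ₂ (Δ₂ g i) j * K) * Δ₁ g i) v
      = φ (K * (Coalgebra.counit (R := ℂ) (Δ₂ g i) • Δ₁ g i)) v := by
    intro i
    rw [← MultilinearMap.sum_apply, ← map_sum]
    simp only [← mul_assoc]
    rw [← Finset.sum_mul, ← Finset.sum_mul, antip_sum N Δ₁ Δ₂ hrep]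
    simp [Algebra.algebraMap_eq_smul_one]
  rw [Finset.sum_congr rfl fun i _ => h2 i, ← MultilinearMap.sum_apply, ← map_sum,
    ← Finset.mul_sum, counit_sum' N Δ₁ Δ₂ hrep]
  rfl

theorem psiAux_zero (k : ℕ) (g : H) (x : Fin k → A × H) (F : H → (Fin k → A) → ℂ)
    (hF : ∀ h v, F h v = 0) : psiAux N Δ₁ Δ₂ ρ k g x F = 0 := by
  induction k generalizing g with
  | zero => simp [psiAux, hF]
  | succ k ih =>
    simp only [psiAux]
    exact Finset.sum_eq_zero fun i _ => ih _ _ _ fun _ _ => hF _ _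

theorem psiAux_norm
    (hact_one : ∀ h : H, ρ h 1 = (Coalgebra.counit (R := ℂ) h) • (1 : A))
    (k : ℕ) (g : H) (x : Fin k → A × H) (F : H → (Fin k → A) → ℂ)
    (hF : ∀ h v, (∃ j, ∃ c : ℂ, v j = c • (1 : A)) → F h v = 0)
    (j : Fin k) (hj : (x j).1 = 1) : psiAux N Δ₁ Δ₂ ρ k g x F = 0 := by
  induction k generalizing g with
  | zero => exact j.elim0
  | succ k ih =>
    simp only [psiAux]
    refine Finset.sum_eq_zero fun i _ => ?_
    revert hj
    refine Fin.cases (fun hj => ?_) (fun j hj => ?_) j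
    · exact psiAux_zero _ _ _ _ _ _ _ _ fun h v => hF _ _ ⟨0, _, by simp [hj, hact_one]; rfl⟩
    · refine ih _ _ _ (fun h v ⟨l, c, hl⟩ => hF _ _ ⟨l.succ, c, by simpa using hl⟩) j hj

theorem faceTup_zero_zero {α : Type} {n : ℕ} (y : α) (x : Fin (n+2) → α) :
    faceTup 0 y x 0 = y := by simp [faceTup]

theorem faceTup_zero_succ {α : Type} {n : ℕ} (y : α) (x : Fin (n+2) → α) :
    (fun k : Fin n => faceTup 0 y x k.succ) = fun k => x k.succ.succ := by
  funext k; simp [faceTup]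

theorem faceTup_succ_zero {α : Type} {n : ℕ} (j : Fin (n+1)) (y : α) (x : Fin (n+3) → α) :
    faceTup j.succ y x 0 = x 0 := by simp [faceTup]

theorem faceTup_succ_succ {α : Type} {n : ℕ} (j : Fin (n+1)) (y : α) (x : Fin (n+3) → α) :
    (fun k : Fin (n+1) => faceTup j.succ y x k.succ) = faceTup j y (fun k => x k.succ) := by
  funext k; simp [faceTup]

/-- right multiplication by `1 ⊗ g` in the first slot -/
theorem baseR
    (hrep : ∀ g : H, (Coalgebra.comul (R := ℂ) g : H ⊗[ℂ] H) =
      ∑ i ∈ Finset.range (N g), Δ₁ g i ⊗ₜ[ℂ] Δ₂ g i)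
    (hact_one : ∀ h : H, ρ h 1 = (Coalgebra.counit (R := ℂ) h) • (1 : A))
    (k : ℕ) (x : Fin (k+2) → A × H) (hx : (x 1).1 = 1) (F : VV H A (k+1)) (G : H) :
    ∑ m ∈ Finset.range (N (x 0).2),
      LL ρ (k+1) (faceTup 0 (cpPairTerm Δ₁ Δ₂ ρ (x 0) (x 1) m) x) F G =
    ∑ i ∈ Finset.range (N G), LL ρ k (fun j => x j.succ.succ)
      (cc k F (ρ (Δ₁ G i) (x 0).1)) (Δ₂ G i * ((x 0).2 * (x 1).2)) := by
  simp only [LL_succ N Δ₁ Δ₂ ρ hrep, faceTup_zero_zero, faceTup_zero_succ]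
  rw [Finset.sum_comm]
  refine Finset.sum_congr rfl fun i _ => ?_
  simp only [cpPairTerm, hx, hact_one, mul_smul_comm, mul_one, map_smul, LinearMap.smul_apply]
  simp only [← map_smul, ← mul_smul_comm]
  rw [← map_sum, ← Finset.mul_sum]
  simp only [mul_smul_comm, ← smul_mul_assoc]
  rw [← Finset.sum_mul, counit_sum N Δ₁ Δ₂ hrep]

/-- product formula in the first slot -/
theorem baseL
    (hrep : ∀ g : H, (Coalgebra.comul (R := ℂ) g : H ⊗[ℂ] H) =
      ∑ i ∈ Finset.range (N g), Δ₁ g i ⊗ₜ[ℂ] Δ₂ g i)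
    (hρ_mul : ∀ g h : H, ρ (g * h) = ρ g ∘ₗ ρ h)
    (k : ℕ) (x : Fin (k+1) → A × H) (h : H) (y : ℕ → Fin (k+1) → A × H)
    (hy0 : ∀ m, y m 0 = (ρ (Δ₁ h m) (x 0).1, Δ₂ h m * (x 0).2))
    (hy : ∀ m, (fun j : Fin k => y m j.succ) = fun j => x j.succ)
    (F : VV H A (k+1)) (G : H) :
    ∑ m ∈ Finset.range (N h), LL ρ (k+1) (y m) F G = LL ρ (k+1) x F (G * h) := by
  simp only [LL_succ N Δ₁ Δ₂ ρ hrep, hy0, hy]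
  have := comul_mul_sum N Δ₁ Δ₂ hrep (LinearMap.mk₂ ℂ
          (fun u v : H => LL ρ k (fun j => x j.succ) (cc k F (ρ u (x 0).1)) (v * (x 0).2))
          (by intros; simp) (by intros; simp) (by intros; simp [add_mul]) (by intros; simp)) G h
  simp only [LinearMap.mk₂_apply] at this
  rw [this, Finset.sum_comm]
  simp only [hρ_mul, mul_assoc, LinearMap.comp_apply]

theorem face_mid
    (hrep : ∀ g : H, (Coalgebra.comul (R := ℂ) g : H ⊗[ℂ] H) =
      ∑ i ∈ Finset.range (N g), Δ₁ g i ⊗ₜ[ℂ] Δ₂ g i)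
    (hρ_mul : ∀ g h : H, ρ (g * h) = ρ g ∘ₗ ρ h)
    (hact_one : ∀ h : H, ρ h 1 = (Coalgebra.counit (R := ℂ) h) • (1 : A))
    (k : ℕ) (j : Fin k) (x : Fin (k+2) → A × H) (hx : (x j.succ.castSucc).1 = 1)
    (F : VV H A (k+1)) (G : H) :
    ∑ m ∈ Finset.range (N (x j.castSucc.castSucc).2),
      LL ρ (k+1) (faceTup j.castSucc
        (cpPairTerm Δ₁ Δ₂ ρ (x j.castSucc.castSucc) (x j.castSucc.succ) m) x) F G =
    ∑ m ∈ Finset.range (N (x j.succ.castSucc).2),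
      LL ρ (k+1) (faceTup j.succ
        (cpPairTerm Δ₁ Δ₂ ρ (x j.succ.castSucc) (x j.succ.succ) m) x) F G := by
  induction k generalizing G with
  | zero => exact j.elim0
  | succ k ih =>
    revert hx
    refine Fin.cases (fun hx => ?_) (fun j hx => ?_) j
    · refine (baseR N Δ₁ Δ₂ ρ hrep hact_one (k+1) x hx F G).trans ?_
      simp only [LL_succ N Δ₁ Δ₂ ρ hrep (k+1), faceTup_succ_zero, faceTup_succ_succ]
      rw [Finset.sum_comm]
      refine Finset.sum_congr rfl fun i _ => ?_
      rw [← mul_assoc]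
      refine (baseL N Δ₁ Δ₂ ρ hrep hρ_mul k (fun j => x j.succ.succ) (x 1).2 _ ?_ ?_ _ _).symm
      · intro m
        rw [faceTup_zero_zero]
        have h1 : (x (Fin.castSucc (Fin.succ 0))).1 = 1 := hx
        simp only [cpPairTerm, h1, one_mul]
        rfl
      · intro m
        rw [faceTup_zero_succ]
    · simp only [LL_succ N Δ₁ Δ₂ ρ hrep (k+1), Fin.castSucc_succ, faceTup_succ_zero,
        faceTup_succ_succ]
      rw [Finset.sum_comm]
      conv_rhs => rw [Finset.sum_comm]
      refine Finset.sum_congr rfl fun i _ => ?_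
      exact ih j (fun l => x l.succ) hx _ _

theorem face_last
    (hrep : ∀ g : H, (Coalgebra.comul (R := ℂ) g : H ⊗[ℂ] H) =
      ∑ i ∈ Finset.range (N g), Δ₁ g i ⊗ₜ[ℂ] Δ₂ g i)
    (hact_one : ∀ h : H, ρ h 1 = (Coalgebra.counit (R := ℂ) h) • (1 : A))
    (k : ℕ) (x : Fin (k+2) → A × H) (hx : (x (Fin.last (k+1))).1 = 1)
    (F : VV H A (k+1)) (G : H) :
    ∑ m ∈ Finset.range (N (x (Fin.last k).castSucc).2),
      LL ρ (k+1) (faceTup (Fin.last k)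
        (cpPairTerm Δ₁ Δ₂ ρ (x (Fin.last k).castSucc) (x (Fin.last k).succ) m) x) F G =
    LL ρ (k+1) (fun j => x j.castSucc) (rmul (k+1) (x (Fin.last (k+1))).2 F) G := by
  induction k generalizing G with
  | zero =>
    refine (baseR N Δ₁ Δ₂ ρ hrep hact_one 0 x hx F G).trans ?_
    rw [LL_succ N Δ₁ Δ₂ ρ hrep]
    refine Finset.sum_congr rfl fun i _ => ?_
    rw [LL_zero, LL_zero, cc_apply, cc_apply, ← mul_assoc]
    rfl
  | succ k ih =>
    simp only [← Fin.succ_last k]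
    simp only [LL_succ N Δ₁ Δ₂ ρ hrep (k+1), Fin.castSucc_succ, faceTup_succ_zero,
        faceTup_succ_succ]
    rw [Finset.sum_comm]
    refine Finset.sum_congr rfl fun i _ => ?_
    exact ih (fun l => x l.succ) hx _ _

end

/-- If `φ` is a normalized equivariant cochain, then `Ψφ` is
`H`-constant: both `Ψφ` and `b(Ψφ)` vanish on elementary-tensor tuples whenever
some argument in position `≥ 1` is of the form `1 ⊗ h`. -/
theorem statement18 {n : ℕ}
    (N : H → ℕ) (Δ₁ Δ₂ : H → ℕ → H)
    (hrep : ∀ g : H, (Coalgebra.comul (R := ℂ) g : H ⊗[ℂ] H) =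
      ∑ i ∈ Finset.range (N g), Δ₁ g i ⊗ₜ[ℂ] Δ₂ g i)
    (ρ : H →ₗ[ℂ] A →ₗ[ℂ] A)
    (hρ_one : ρ 1 = LinearMap.id)
    (hρ_mul : ∀ g h : H, ρ (g * h) = ρ g ∘ₗ ρ h)
    (hact_mul : ∀ (h : H) (a b : A),
      ρ h (a * b) = ∑ i ∈ Finset.range (N h), ρ (Δ₁ h i) a * ρ (Δ₂ h i) b)
    (hact_one : ∀ h : H, ρ h 1 = (Coalgebra.counit (R := ℂ) h) • (1 : A))
    (φ : H →ₗ[ℂ] MultilinearMap ℂ (fun _ : Fin (n+1) => A) ℂ)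
    (hequiv : IsEquivariant N Δ₁ Δ₂ ρ (fun h a => φ h a))
    (hnorm : ∀ (h : H) (a : Fin (n+1) → A), (∃ j, a j = 1) → φ h a = 0) :
    (∀ x : Fin (n+1) → A × H,
      (∃ j : Fin (n+1), 0 < (j : ℕ) ∧ (x j).1 = 1) →
        psiV N Δ₁ Δ₂ ρ (fun h a => φ h a) x = 0)
    ∧ (∀ x : Fin (n+2) → A × H,
      (∃ j : Fin (n+2), 0 < (j : ℕ) ∧ (x j).1 = 1) →
        (∑ j : Fin (n+1), (-1 : ℂ) ^ (j : ℕ) *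
            ∑ m ∈ Finset.range (N (x j.castSucc).2),
              psiV N Δ₁ Δ₂ ρ (fun h a => φ h a)
                (faceTup j (cpPairTerm Δ₁ Δ₂ ρ (x j.castSucc) (x j.succ) m) x))
        + (-1 : ℂ) ^ (n+1) *
            ∑ m ∈ Finset.range (N (x (Fin.last (n+1))).2),
              psiV N Δ₁ Δ₂ ρ (fun h a => φ h a)
                (fun k => if (k : ℕ) = 0
                  then cpPairTerm Δ₁ Δ₂ ρ (x (Fin.last (n+1))) (x 0) m
                  else x k.castSucc)
        = 0) := by
  have P1 : ∀ x : Fin (n+1) → A × H,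
      (∃ j : Fin (n+1), 0 < (j : ℕ) ∧ (x j).1 = 1) →
        psiV N Δ₁ Δ₂ ρ (fun h a => φ h a) x = 0 := by
    rintro x ⟨j, hj, hx⟩
    obtain ⟨i, rfl⟩ := Fin.exists_succ_eq.2 (show j ≠ 0 by rintro rfl; simp at hj)
    refine psiAux_norm N Δ₁ Δ₂ ρ hact_one n _ _ _ ?_ i hx
    rintro h v ⟨l, c, hl⟩
    have h1 : (Fin.cons (x 0).1 v : Fin (n+1) → A) =
        Function.update (Fin.cons (x 0).1 v : Fin (n+1) → A) l.succ (c • (1 : A)) := by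
      rw [← hl]
      exact (Function.update_eq_self_iff.2 (by simp)).symm
    simp only
    rw [h1, MultilinearMap.map_update_smul, hnorm _ _ ⟨l.succ, by simp⟩, smul_zero]
  refine ⟨P1, ?_⟩
  rintro x ⟨j, hj, hx⟩
  have hv : ∀ i : Fin (n+1), (j : ℕ) ≠ i → (j : ℕ) ≠ i + 1 →
      (-1 : ℂ) ^ (i : ℕ) * ∑ m ∈ Finset.range (N (x i.castSucc).2),
              psiV N Δ₁ Δ₂ ρ (fun h a => φ h a)
                (faceTup i (cpPairTerm Δ₁ Δ₂ ρ (x i.castSucc) (x i.succ) m) x) = 0 := by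
    intro i h1 h2
    rw [Finset.sum_eq_zero, mul_zero]
    intro m _
    apply P1
    have hi := i.2
    have hj2 := j.2
    by_cases hlt : (j : ℕ) < i
    · refine ⟨⟨j, by omega⟩, hj, ?_⟩
      simp only [faceTup, hlt, if_true]
      exact hx
    · refine ⟨⟨j - 1, by omega⟩, by simp only; omega, ?_⟩
      have e1 : ¬ ((j : ℕ) - 1 < i) := by omega
      have e2 : (⟨j - 1, by omega⟩ : Fin (n+1)) ≠ i := by
        intro e; have := congrArg Fin.val e; simp only at this; omega
      simp only [faceTup, e1, e2, if_false]
      have e3 : (⟨j - 1, by omega⟩ : Fin (n+1)).succ = j := by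
        ext; simp only [Fin.val_succ]; omega
      rw [e3]; exact hx
  have hψ := psiV_eq N Δ₁ Δ₂ ρ hrep hρ_one n φ
  by_cases hl : j = Fin.last (n+1)
  · subst hl
    rw [Finset.sum_eq_single (Fin.last n)]
    · simp only [hψ]
      rw [face_last N Δ₁ Δ₂ ρ hrep hact_one n x hx,
        baseL N Δ₁ Δ₂ ρ hrep hρ_mul n (fun j => x j.castSucc) (x (Fin.last (n+1))).2 _ ?_ ?_,
        one_mul, ← actF_equiv N Δ₁ Δ₂ ρ hrep n φ hequiv,
        ← LL_mul N Δ₁ Δ₂ ρ hrep hρ_mul, mul_one]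
      · simp [pow_succ]
      · intro m
        simp [cpPairTerm, hx]
      · intro m
        funext l
        simp
    · intro i _ hi
      apply hv
      · have := i.2; simp only [Fin.val_last]; omega
      · intro e
        apply hi
        ext
        simp only [Fin.val_last] at e ⊢
        omega
    · simp
  · have hj2 := j.2
    have hj3 : (j : ℕ) ≠ n + 1 := fun e => hl (Fin.ext e)
    obtain ⟨i, hi⟩ : ∃ i : Fin n, j = i.succ.castSucc :=
      ⟨⟨j - 1, by omega⟩, by ext; simp; omega⟩
    subst hi
    rw [Fintype.sum_eq_add i.castSucc i.succ]
    · simp only [hψ]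
      rw [face_mid N Δ₁ Δ₂ ρ hrep hρ_mul hact_one n i x hx]
      rw [Finset.sum_eq_zero (s := Finset.range (N (x (Fin.last (n+1))).2))]
      · simp [pow_succ]
      · intro m _
        rw [← hψ]
        exact P1 _ ⟨i.succ, by simp, by simpa using hx⟩
    · intro e; have := congrArg Fin.val e; simp at this
    · rintro l ⟨h1, h2⟩
      apply hv
      · intro e; exact h2 (Fin.ext (by simpa using e.symm))
      · intro e; exact h1 (Fin.ext (by simpa using e.symm))

end
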